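/- arXiv:math/0412065 — 2 statements merged into one kernel-verified Lean document; each statement's English description precedes it below -/
import Mathlib

section
/- Let a, b, b', c ∈ ℂ and let U ⊆ ℂ × ℂ be an open set such that for every (x,y) ∈ U the numbers x, y, x−1, y−1 and x−y are all nonzero. Suppose z₁, z₂, z₃ : U → ℂ have continuous partial derivatives up to order two and each z = zᵢ satisfies on U the Appell system: ∂²z/∂x² + ((c−b')/x + (a+b−c+1)/(x−1) + b'/(x−y))·∂z/∂x − (b·y(y−1)/(x(x−1)(x−y)))·∂z/∂y + (ab/(x(x−1)))·z = 0; ∂²z/∂y² + ((c−b)/y + (a+b'−c+1)/(y−1) + b/(y−x))·∂z/∂y − (b'·x(x−1)/(y(y−1)(y−x)))·∂z/∂x + (ab'/(y(y−1)))·z = 0; ∂²z/∂x∂y = (b'/(x−y))·∂z/∂x − (b/(x−y))·∂z/∂y. Let Δ(x,y) be the determinant of the 3×3 matrix whose i-th row is (∂zᵢ/∂x, ∂zᵢ/∂y, zᵢ). Then on U one has ∂Δ/∂x = −((c−b')/x + (a+b−c+1)/(x−1) + (b+b')/(x−y))·Δ and ∂Δ/∂y = −((c−b)/y + (a+b'−c+1)/(y−1)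 + (b+b')/(y−x))·Δ. -/
noncomputable section

/-- Complex partial derivative in the first variable of a function of two complex variables. -/
def pd₁ (f : ℂ → ℂ → ℂ) (x y : ℂ) : ℂ := deriv (fun t => f t y) x
/-- Complex partial derivative in the second variable of a function of two complex variables. -/
def pd₂ (f : ℂ → ℂ → ℂ) (x y : ℂ) : ℂ := deriv (fun t => f x t) y

/-- The Appell hypergeometric system (1.2) for a function z of two complex variables,
holding at the point (x, y). -/
def AppellSystem (a b b' c : ℂ) (z : ℂ → ℂ → ℂ) (x y : ℂ) : Prop :=
  (pd₁ (pd₁ z) x y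
      + ((c - b')/x + (a + b - c + 1)/(x - 1) + b'/(x - y)) * pd₁ z x y
      - (b * y * (y - 1) / (x * (x - 1) * (x - y))) * pd₂ z x y
      + (a*b / (x * (x - 1))) * z x y = 0) ∧
  (pd₂ (pd₂ z) x y
      + ((c - b)/y + (a + b' - c + 1)/(y - 1) + b/(y - x)) * pd₂ z x y
      - (b' * x * (x - 1) / (y * (y - 1) * (y - x))) * pd₁ z x y
      + (a*b' / (y * (y - 1))) * z x y = 0) ∧
  (pd₁ (pd₂ z) x y = (b'/(x - y)) * pd₁ z x y - (b/(x - y)) * pd₂ z x y)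

theorem hasDerivAt_fst_slice {f : ℂ → ℂ → ℂ} {L : ℂ × ℂ →L[ℂ] ℂ} {x y : ℂ}
    (hf : HasFDerivAt (fun p : ℂ × ℂ => f p.1 p.2) L (x, y)) :
    HasDerivAt (fun t => f t y) (L (1, 0)) x :=
  hf.comp_hasDerivAt (f := fun t => (t, y)) x ((hasDerivAt_id x).prodMk (hasDerivAt_const x y))

theorem hasDerivAt_snd_slice {f : ℂ → ℂ → ℂ} {L : ℂ × ℂ →L[ℂ] ℂ} {x y : ℂ}
    (hf : HasFDerivAt (fun p : ℂ × ℂ => f p.1 p.2) L (x, y)) :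
    HasDerivAt (fun t => f x t) (L (0, 1)) y :=
  hf.comp_hasDerivAt (f := fun t => (x, t)) y ((hasDerivAt_const y x).prodMk (hasDerivAt_id y))

theorem hasDerivAt_pd₁ {f : ℂ → ℂ → ℂ} {x y : ℂ}
    (hf : DifferentiableAt ℂ (fun p : ℂ × ℂ => f p.1 p.2) (x, y)) :
    HasDerivAt (fun t => f t y) (pd₁ f x y) x :=
  (hasDerivAt_fst_slice hf.hasFDerivAt).differentiableAt.hasDerivAt

theorem hasDerivAt_pd₂ {f : ℂ → ℂ → ℂ} {x y : ℂ}
    (hf : DifferentiableAt ℂ (fun p : ℂ × ℂ => f p.1 p.2) (x, y)) :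
    HasDerivAt (fun t => f x t) (pd₂ f x y) y :=
  (hasDerivAt_snd_slice hf.hasFDerivAt).differentiableAt.hasDerivAt

theorem eventually_differentiableAt {f : ℂ × ℂ → ℂ} {p : ℂ × ℂ} (hf : ContDiffAt ℂ 2 f p) :
    ∀ᶠ q in nhds p, DifferentiableAt ℂ f q := by
  filter_upwards [hf.eventually (by simp)] with q hq
  exact hq.differentiableAt (by simp)

theorem hasFDerivAt_fderiv_apply {f : ℂ × ℂ → ℂ} {p : ℂ × ℂ} (hf : ContDiffAt ℂ 2 f p)
    (v : ℂ × ℂ) :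
    HasFDerivAt (fun q => fderiv ℂ f q v) ((fderiv ℂ (fderiv ℂ f) p).flip v) p := by
  have h : DifferentiableAt ℂ (fderiv ℂ f) p :=
    (hf.fderiv_right (m := 1) (by norm_num)).differentiableAt (by simp)
  simpa using h.hasFDerivAt.clm_apply (hasFDerivAt_const v p)

theorem hasFDerivAt_uncurry_pd₁ {z : ℂ → ℂ → ℂ} {p : ℂ × ℂ}
    (hz : ContDiffAt ℂ 2 (fun q : ℂ × ℂ => z q.1 q.2) p) :
    HasFDerivAt (fun q : ℂ × ℂ => pd₁ z q.1 q.2)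
      ((fderiv ℂ (fderiv ℂ (fun q : ℂ × ℂ => z q.1 q.2)) p).flip (1, 0)) p := by
  refine (hasFDerivAt_fderiv_apply hz (1, 0)).congr_of_eventuallyEq ?_
  filter_upwards [eventually_differentiableAt hz] with q hq
  exact (hasDerivAt_fst_slice (f := z) hq.hasFDerivAt).deriv

theorem hasFDerivAt_uncurry_pd₂ {z : ℂ → ℂ → ℂ} {p : ℂ × ℂ}
    (hz : ContDiffAt ℂ 2 (fun q : ℂ × ℂ => z q.1 q.2) p) :
    HasFDerivAt (fun q : ℂ × ℂ => pd₂ z q.1 q.2)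
      ((fderiv ℂ (fderiv ℂ (fun q : ℂ × ℂ => z q.1 q.2)) p).flip (0, 1)) p := by
  refine (hasFDerivAt_fderiv_apply hz (0, 1)).congr_of_eventuallyEq ?_
  filter_upwards [eventually_differentiableAt hz] with q hq
  exact (hasDerivAt_snd_slice (f := z) hq.hasFDerivAt).deriv

theorem pd₂_pd₁_eq_pd₁_pd₂ {z : ℂ → ℂ → ℂ} {x y : ℂ}
    (hz : ContDiffAt ℂ 2 (fun q : ℂ × ℂ => z q.1 q.2) (x, y)) :
    pd₂ (pd₁ z) x y = pd₁ (pd₂ z) x y := by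
  have h₁ := (hasDerivAt_snd_slice (f := pd₁ z) (hasFDerivAt_uncurry_pd₁ hz)).deriv
  have h₂ := (hasDerivAt_fst_slice (f := pd₂ z) (hasFDerivAt_uncurry_pd₂ hz)).deriv
  have hsymm : IsSymmSndFDerivAt ℂ (fun q : ℂ × ℂ => z q.1 q.2) (x, y) :=
    hz.isSymmSndFDerivAt (by simp)
  exact h₁.trans ((hsymm (0, 1) (1, 0)).trans h₂.symm)

/-- Liouville's formula for three solutions `(u i, v i, w i)` of a linear system: the logarithmic
derivative of their Wronskian is the trace of the coefficient matrix. -/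
theorem HasDerivAt.det_fin_three_of_linear {u v w : Fin 3 → ℂ → ℂ} {t : ℂ}
    {p₁ q₁ r₁ p₂ q₂ r₂ p₃ q₃ r₃ : ℂ}
    (hu : ∀ i, HasDerivAt (u i) (p₁ * u i t + q₁ * v i t + r₁ * w i t) t)
    (hv : ∀ i, HasDerivAt (v i) (p₂ * u i t + q₂ * v i t + r₂ * w i t) t)
    (hw : ∀ i, HasDerivAt (w i) (p₃ * u i t + q₃ * v i t + r₃ * w i t) t) :
    HasDerivAt
      (fun s => Matrix.det !![u 0 s, v 0 s, w 0 s; u 1 s, v 1 s, w 1 s; u 2 s, v 2 s, w 2 s])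
      ((p₁ + q₂ + r₃) *
        Matrix.det !![u 0 t, v 0 t, w 0 t; u 1 t, v 1 t, w 1 t; u 2 t, v 2 t, w 2 t]) t := by
  have hprod (i j k : Fin 3) := ((hu i).fun_mul (hv j)).fun_mul (hw k)
  refine ((((((hprod 0 1 2).fun_sub (hprod 0 2 1)).fun_sub (hprod 1 0 2)).fun_add
    (hprod 1 2 0)).fun_add (hprod 2 0 1)).fun_sub (hprod 2 1 0)).congr_of_eventuallyEq
      (.of_forall fun s => ?_) |>.congr_deriv ?_
  all_goals
    simp only [Matrix.det_fin_three, Matrix.of_apply, Matrix.cons_val]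
    ring

theorem wronskian_derivative (a b b' c : ℂ)
    (U : Set (ℂ × ℂ)) (hU : IsOpen U)
    (hne : ∀ p ∈ U, p.1 ≠ 0 ∧ p.2 ≠ 0 ∧ p.1 - 1 ≠ 0 ∧ p.2 - 1 ≠ 0 ∧ p.1 - p.2 ≠ 0)
    (z₁ z₂ z₃ : ℂ → ℂ → ℂ)
    (hz₁ : ContDiffOn ℂ 2 (fun p : ℂ × ℂ => z₁ p.1 p.2) U)
    (hz₂ : ContDiffOn ℂ 2 (fun p : ℂ × ℂ => z₂ p.1 p.2) U)
    (hz₃ : ContDiffOn ℂ 2 (fun p : ℂ × ℂ => z₃ p.1 p.2) U)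
    (heq₁ : ∀ p ∈ U, AppellSystem a b b' c z₁ p.1 p.2)
    (heq₂ : ∀ p ∈ U, AppellSystem a b b' c z₂ p.1 p.2)
    (heq₃ : ∀ p ∈ U, AppellSystem a b b' c z₃ p.1 p.2)
    (Δ : ℂ → ℂ → ℂ)
    (hΔ : Δ = fun x y => Matrix.det
      !![pd₁ z₁ x y, pd₂ z₁ x y, z₁ x y;
         pd₁ z₂ x y, pd₂ z₂ x y, z₂ x y;
         pd₁ z₃ x y, pd₂ z₃ x y, z₃ x y]) :
    ∀ p ∈ U,
      pd₁ Δ p.1 p.2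
        = -((c - b')/p.1 + (a + b - c + 1)/(p.1 - 1) + (b + b')/(p.1 - p.2)) * Δ p.1 p.2 ∧
      pd₂ Δ p.1 p.2
        = -((c - b)/p.2 + (a + b' - c + 1)/(p.2 - 1) + (b + b')/(p.2 - p.1)) * Δ p.1 p.2 := by
  rintro ⟨x, y⟩ hp
  obtain ⟨z, rfl, rfl, rfl⟩ : ∃ z : Fin 3 → ℂ → ℂ → ℂ, z 0 = z₁ ∧ z 1 = z₂ ∧ z 2 = z₃ :=
    ⟨![z₁, z₂, z₃], rfl, rfl, rfl⟩
  have hz : ∀ i, ContDiffAt ℂ 2 (fun q : ℂ × ℂ => z i q.1 q.2) (x, y)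
    | 0 => hz₁.contDiffAt (hU.mem_nhds hp)
    | 1 => hz₂.contDiffAt (hU.mem_nhds hp)
    | 2 => hz₃.contDiffAt (hU.mem_nhds hp)
  have heq : ∀ i, AppellSystem a b b' c (z i) x y
    | 0 => heq₁ _ hp
    | 1 => heq₂ _ hp
    | 2 => heq₃ _ hp
  have hdz (i : Fin 3) := (hz i).differentiableAt (by simp)
  have hd₁ (i : Fin 3) := (hasFDerivAt_uncurry_pd₁ (hz i)).differentiableAt
  have hd₂ (i : Fin 3) := (hasFDerivAt_uncurry_pd₂ (hz i)).differentiableAt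
  have hswap : (y - x)⁻¹ = -(x - y)⁻¹ := by rw [← inv_neg, neg_sub]
  subst hΔ
  constructor
  · refine (HasDerivAt.det_fin_three_of_linear
      (u := fun i s => pd₁ (z i) s y) (v := fun i s => pd₂ (z i) s y) (w := fun i s => z i s y)
      (p₁ := -((c - b')/x + (a + b - c + 1)/(x - 1) + b'/(x - y)))
      (q₁ := b * y * (y - 1) / (x * (x - 1) * (x - y))) (r₁ := -(a * b / (x * (x - 1))))
      (p₂ := b'/(x - y)) (q₂ := -(b/(x - y))) (r₂ := 0) (p₃ := 1) (q₃ := 0) (r₃ := 0)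
      (fun i => (hasDerivAt_pd₁ (hd₁ i)).congr_deriv ?_)
      (fun i => (hasDerivAt_pd₁ (hd₂ i)).congr_deriv ?_)
      (fun i => (hasDerivAt_pd₁ (hdz i)).congr_deriv ?_)).deriv.trans ?_
    · linear_combination (heq i).1
    · linear_combination (heq i).2.2
    · ring
    · congr 1
      ring
  · refine (HasDerivAt.det_fin_three_of_linear
      (u := fun i s => pd₁ (z i) x s) (v := fun i s => pd₂ (z i) x s) (w := fun i s => z i x s)
      (p₁ := b'/(x - y)) (q₁ := -(b/(x - y))) (r₁ := 0)
      (p₂ := b' * x * (x - 1) / (y * (y - 1) * (y - x)))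
      (q₂ := -((c - b)/y + (a + b' - c + 1)/(y - 1) + b/(y - x)))
      (r₂ := -(a * b' / (y * (y - 1)))) (p₃ := 0) (q₃ := 1) (r₃ := 0)
      (fun i => (hasDerivAt_pd₂ (hd₁ i)).congr_deriv ?_)
      (fun i => (hasDerivAt_pd₂ (hd₂ i)).congr_deriv ?_)
      (fun i => (hasDerivAt_pd₂ (hdz i)).congr_deriv ?_)).deriv.trans ?_
    · linear_combination pd₂_pd₁_eq_pd₁_pd₂ (hz i) + (heq i).2.2
    · linear_combination (heq i).2.1
    · ring
    · congr 1
      simp only [div_eq_mul_inv, hswap]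
      ring
end
end

section
/- For all ξ, η ∈ ℂ, the determinant of the 3×3 matrix with rows (∂C₆/∂ξ, ∂C₆/∂η, 2·C₆), (∂C₉/∂ξ, ∂C₉/∂η, 3·C₉), (∂𝔠₁₂/∂ξ, ∂𝔠₁₂/∂η, 4·𝔠₁₂) equals (1/2)·(C₁₂² − C₆·C₁₈). -/
noncomputable section

/-- Affine Hessian invariant C₆. -/
def C₆ : ℂ → ℂ → ℂ := fun ξ η => ξ^6 + η^6 + 1 - 10*(ξ^3*η^3 + ξ^3 + η^3)
/-- Affine Hessian invariant C₉. -/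
def C₉ : ℂ → ℂ → ℂ := fun ξ η => (ξ^3 - η^3)*(η^3 - 1)*(1 - ξ^3)
/-- Affine Hessian invariant C₁₂. -/
def C₁₂ : ℂ → ℂ → ℂ := fun ξ η => (ξ^3 + η^3 + 1)*((ξ^3 + η^3 + 1)^3 + 216*ξ^3*η^3)
/-- Affine Hessian invariant 𝔠₁₂. -/
def 𝔠₁₂ : ℂ → ℂ → ℂ := fun ξ η => ξ*η*(27*ξ^3*η^3 - (ξ^3 + η^3 + 1)^3)
/-- Affine Hessian invariant C₁₈. -/
def C₁₈ : ℂ → ℂ → ℂ := fun ξ η => (ξ^3 + η^3 + 1)^6 - 540*ξ^3*η^3*(ξ^3 + η^3 + 1)^3 - 5832*ξ^6*η^6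

/-- Complex partial derivative in the first variable. -/
def pdξ (f : ℂ → ℂ → ℂ) (ξ η : ℂ) : ℂ := deriv (fun t => f t η) ξ
/-- Complex partial derivative in the second variable. -/
def pdη (f : ℂ → ℂ → ℂ) (ξ η : ℂ) : ℂ := deriv (fun t => f ξ t) η

lemma pdξ_C₆ (ξ η : ℂ) : pdξ C₆ ξ η = 6 * ξ ^ 5 - 30 * ξ ^ 2 * (η ^ 3 + 1) := by
  have h₃ := hasDerivAt_pow 3 ξ
  refine (((((hasDerivAt_pow 6 ξ).add_const (η ^ 6)).add_const 1).sub
    ((((h₃.mul_const (η ^ 3)).add h₃).add_const (η ^ 3)).const_mul 10)).congr_deriv ?_).deriv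
  push_cast
  ring

lemma pdξ_C₉ (ξ η : ℂ) :
    pdξ C₉ ξ η = 3 * ξ ^ 2 * (η ^ 3 - 1) * (1 + η ^ 3 - 2 * ξ ^ 3) := by
  have h₃ := hasDerivAt_pow 3 ξ
  refine ((((h₃.sub_const (η ^ 3)).mul_const (η ^ 3 - 1)).mul
    (h₃.const_sub 1)).congr_deriv ?_).deriv
  push_cast
  ring

lemma pdξ_𝔠₁₂ (ξ η : ℂ) :
    pdξ 𝔠₁₂ ξ η = η * (27 * ξ ^ 3 * η ^ 3 - (ξ ^ 3 + η ^ 3 + 1) ^ 3)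
      + 9 * ξ ^ 3 * η * (9 * η ^ 3 - (ξ ^ 3 + η ^ 3 + 1) ^ 2) := by
  have h₃ := hasDerivAt_pow 3 ξ
  refine ((((hasDerivAt_id' ξ).mul_const η).mul (((h₃.const_mul 27).mul_const (η ^ 3)).sub
    (((h₃.add_const (η ^ 3)).add_const 1).pow 3))).congr_deriv ?_).deriv
  simp only [Pi.sub_apply, Pi.pow_apply]
  push_cast
  ring

lemma pdη_eq_pdξ_swap (f : ℂ → ℂ → ℂ) (ξ η : ℂ) : pdη f ξ η = pdξ (fun x y => f y x) η ξ :=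
  rfl

lemma C₆_swap : (fun ξ η => C₆ η ξ) = C₆ := by
  funext ξ η
  simp only [C₆]
  ring

lemma C₉_swap : (fun ξ η => C₉ η ξ) = fun ξ η => -C₉ ξ η := by
  funext ξ η
  simp only [C₉]
  ring

lemma 𝔠₁₂_swap : (fun ξ η => 𝔠₁₂ η ξ) = 𝔠₁₂ := by
  funext ξ η
  simp only [𝔠₁₂]
  ring

lemma pdξ_neg (f : ℂ → ℂ → ℂ) (ξ η : ℂ) : pdξ (fun x y => -f x y) ξ η = -pdξ f ξ η :=
  deriv.fun_neg

theorem det_C6_C9_fC12 (ξ η : ℂ) :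
    Matrix.det !![pdξ C₆ ξ η, pdη C₆ ξ η, 2 * C₆ ξ η;
                  pdξ C₉ ξ η, pdη C₉ ξ η, 3 * C₉ ξ η;
                  pdξ 𝔠₁₂ ξ η, pdη 𝔠₁₂ ξ η, 4 * 𝔠₁₂ ξ η]
      = (1/2) * ((C₁₂ ξ η)^2 - C₆ ξ η * C₁₈ ξ η) := by
  simp only [pdη_eq_pdξ_swap, C₆_swap, C₉_swap, 𝔠₁₂_swap, pdξ_neg, pdξ_C₆, pdξ_C₉, pdξ_𝔠₁₂]
  simp only [Matrix.det_fin_three, Matrix.of_apply, Matrix.cons_val', Matrix.cons_val,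
    C₆, C₉, C₁₂, 𝔠₁₂, C₁₈]
  ring
end
end
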